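/- Let C be a finite type of class labels with at least two elements, and let x be a multiset over C having a unique most frequent label with gap j ≥ 1. Define the distance-k sensitivity S^k(x) = sup over all multisets y over C with ‖x−y‖₁ ≤ k and all labels c ∈ C of |u(c,x) − u(c,y)|. Then S^k(x) = 0 for every natural number k < j, and S^k(x) = 1 for every natural number k ≥ j. -/

import Mathlib

/-- The ℓ₁ distance between two multisets: the minimum number of single-record
additions or removals transforming `x` into `y`. -/
def msDist {C : Type*} [DecidableEq C] (x y : Multiset C) : ℕ :=
  (x - y).card + (y - x).card

/-- The scoring function `u(c, x)`: 1 if `c` is a most frequent label of `x`, 0 otherwise. -/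
noncomputable def score {C : Type*} [Fintype C] [DecidableEq C] (c : C) (x : Multiset C) : ℝ :=
  if x.count c = Finset.univ.sup (fun c' => x.count c') then 1 else 0

/-- The distance-`k` sensitivity of the score at `x`:
`S^k(x) = sup_{y : ‖x−y‖₁ ≤ k} max_{c ∈ C} |u(c,x) − u(c,y)|`. -/
noncomputable def distSens {C : Type*} [Fintype C] [DecidableEq C]
    (x : Multiset C) (k : ℕ) : ℝ :=
  ⨆ y : {y : Multiset C // msDist x y ≤ k}, ⨆ c : C, |score c x - score c (y : Multiset C)|

theorem score_eq_ite {C : Type*} [Fintype C] [DecidableEq C] (c : C) (x : Multiset C) :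
    score c x = if ∀ c', x.count c' ≤ x.count c then 1 else 0 := by
  have h : (x.count c = Finset.univ.sup (fun c' => x.count c')) ↔
      ∀ c', x.count c' ≤ x.count c := by
    constructor
    · intro h c'
      rw [h]
      exact Finset.le_sup (f := fun c' => x.count c') (Finset.mem_univ c')
    · intro h
      exact le_antisymm (Finset.le_sup (f := fun c' => x.count c') (Finset.mem_univ c))
        (Finset.sup_le fun c' _ => h c')
  unfold score
  by_cases h1 : ∀ c', x.count c' ≤ x.count c
  · rw [if_pos h1, if_pos (h.2 h1)]
  · rw [if_neg h1, if_neg (fun h2 => h1 (h.1 h2))]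

theorem score_of_unique {C : Type*} [Fintype C] [DecidableEq C] (c₁ : C) (x : Multiset C)
    (h : ∀ c : C, c ≠ c₁ → x.count c < x.count c₁) (c : C) :
    score c x = if c = c₁ then 1 else 0 := by
  rw [score_eq_ite]
  by_cases hc : c = c₁
  · subst hc
    rw [if_pos rfl, if_pos]
    intro c'
    by_cases h' : c' = c
    · rw [h']
    · exact (h c' h').le
  · rw [if_neg hc, if_neg]
    intro h'
    exact absurd (h' c₁) (not_le.2 (h c hc))

theorem abs_score_sub_le {C : Type*} [Fintype C] [DecidableEq C] (c : C) (x y : Multiset C) :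
    |score c x - score c y| ≤ 1 := by
  unfold score
  split_ifs <;> norm_num

/-- If `C` has at least two labels and `x` has a unique most frequent label `c₁` with gap
`j ≥ 1`, then the distance-`k` sensitivity satisfies `S^k(x) = 0` for `k < j` and
`S^k(x) = 1` for `k ≥ j`. -/
theorem stmt2 {C : Type*} [Fintype C] [DecidableEq C] [Nontrivial C]
    (x : Multiset C) (c₁ : C) (j : ℕ)
    (huniq : ∀ c : C, c ≠ c₁ → x.count c < x.count c₁)
    (hj : j = x.count c₁ - (Finset.univ.erase c₁).sup (fun c => x.count c))
    (hj1 : 1 ≤ j) :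
    (∀ k : ℕ, k < j → distSens x k = 0) ∧ (∀ k : ℕ, j ≤ k → distSens x k = 1) := by
  have hlt : ∀ c, c ≠ c₁ → x.count c + j ≤ x.count c₁ := by
    intro c hc
    have : x.count c ≤ (Finset.univ.erase c₁).sup (fun c => x.count c) :=
      Finset.le_sup (f := fun c => x.count c) (Finset.mem_erase.2 ⟨hc, Finset.mem_univ c⟩)
    omega
  constructor
  · intro k hk
    have key : ∀ (y : {y : Multiset C // msDist x y ≤ k}) (c : C),
        |score c x - score c (y : Multiset C)| = 0 := by
      rintro ⟨y, hy⟩ c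
      rw [score_of_unique c₁ x huniq, score_of_unique c₁ y, sub_self, abs_zero]
      intro c hc
      have h1 := hlt c hc
      have h2 := Multiset.count_le_card c₁ (x - y)
      have h3 := Multiset.count_le_card c (y - x)
      rw [Multiset.count_sub] at h2 h3
      unfold msDist at hy
      omega
    unfold distSens
    simp only [key, Real.iSup_const_zero]
  · intro k hk
    obtain ⟨c₀, hc₀⟩ := exists_ne c₁
    obtain ⟨c₂, hc₂, hm⟩ := Finset.exists_mem_eq_sup (Finset.univ.erase c₁)
      ⟨c₀, Finset.mem_erase.2 ⟨hc₀, Finset.mem_univ _⟩⟩ (fun c => x.count c)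
    have hne : c₂ ≠ c₁ := (Finset.mem_erase.1 hc₂).1
    have hd : msDist x (x + Multiset.replicate j c₂) ≤ k := by
      have h0 : x - (x + Multiset.replicate j c₂) = 0 :=
        tsub_eq_zero_of_le (Multiset.le_add_right _ _)
      simp [msDist, h0, hk]
    have hle : ∀ y : {y : Multiset C // msDist x y ≤ k},
        ⨆ c : C, |score c x - score c (y : Multiset C)| ≤ 1 :=
      fun y => ciSup_le fun c => abs_score_sub_le c x y
    haveI : Nonempty {y : Multiset C // msDist x y ≤ k} := ⟨⟨_, hd⟩⟩
    unfold distSens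
    apply le_antisymm
    · exact ciSup_le hle
    · refine le_trans ?_ (le_ciSup (f := fun y : {y : Multiset C // msDist x y ≤ k} =>
        ⨆ c : C, |score c x - score c (y : Multiset C)|)
        ⟨1, by rintro _ ⟨y, rfl⟩; exact hle y⟩ ⟨_, hd⟩)
      refine le_trans ?_ (le_ciSup (f := fun c : C =>
        |score c x - score c (x + Multiset.replicate j c₂)|)
        ⟨1, by rintro _ ⟨c, rfl⟩; exact abs_score_sub_le c _ _⟩ c₂)
      have hy : score c₂ (x + Multiset.replicate j c₂) = 1 := by
        rw [score_eq_ite, if_pos]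
        intro c
        simp only [Multiset.count_add, Multiset.count_replicate]
        by_cases h2 : c = c₂
        · subst h2; simp
        · rw [if_neg (Ne.symm h2)]
          by_cases h1 : c = c₁
          · subst h1
            simp only [if_true]
            omega
          · have := hlt c h1
            simp only [if_true]
            omega
      simp only [score_of_unique c₁ x huniq, hy, if_neg hne]
      norm_num
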